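/- Let ρ > 0 and 1 < α < 2 be real numbers. Then for every u > 3, ∫_0^∞ K_ρ(u,z) dμ_α(z) ≥ (1/8)·ρ(ρ+1)·(ln(3/2))^2 · (1 + ln 3/ln u)^{−ρ−2} · u^{−α}·(ln u)^{−2} · μ_α([1,2]). -/

import Mathlib

open MeasureTheory

/-- `K_ρ(u,z) := (ln(u+z)/ln u)^{-ρ} + ρ·(ln(u+z)/ln u) − (ρ+1)`. -/
noncomputable def Kfun (ρ u z : ℝ) : ℝ :=
  (Real.log (u + z) / Real.log u) ^ (-ρ) + ρ * (Real.log (u + z) / Real.log u) - (ρ + 1)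

/-- The `α`-stable measure on `(0,∞)` with density
`z ↦ (α(α−1)/Γ(2−α))·z^{−1−α}` with respect to Lebesgue measure. -/
noncomputable def muAlpha (α : ℝ) : Measure ℝ :=
  (volume.withDensity
    (fun z => ENNReal.ofReal ((α * (α - 1) / Real.Gamma (2 - α)) * z ^ (-1 - α)))).restrict
    (Set.Ioi 0)

lemma K_rpow_step (s M x : ℝ) (hs : 0 < s) (h1 : 1 ≤ x) (hM : x ≤ M) :
    x ^ (-s) + s * M ^ (-s - 1) * x ≤ 1 + s * M ^ (-s - 1) := by
  have hd : ∀ t ∈ Set.Icc 1 M, HasDerivAt (fun t : ℝ => t ^ (-s) + s * M ^ (-s - 1) * t)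
      (-s * t ^ (-s - 1) + s * M ^ (-s - 1)) t := by
    intro t ht
    have h0 : t ≠ 0 := by linarith [ht.1]
    have := (Real.hasDerivAt_rpow_const (x := t) (p := -s) (Or.inl h0)).add
      ((hasDerivAt_id t).const_mul (s * M ^ (-s - 1)))
    exact this.congr_deriv (by simp)
  have anti : AntitoneOn (fun t : ℝ => t ^ (-s) + s * M ^ (-s - 1) * t) (Set.Icc 1 M) := by
    apply antitoneOn_of_deriv_nonpos (convex_Icc 1 M)
    · intro t ht
      exact (hd t ht).continuousAt.continuousWithinAt
    · intro t ht
      exact (hd t (interior_subset ht)).differentiableAt.differentiableWithinAt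
    · intro t ht
      have ht' := interior_subset ht
      rw [(hd t ht').deriv]
      have : M ^ (-s - 1) ≤ t ^ (-s - 1) :=
        Real.rpow_le_rpow_of_nonpos (by linarith [ht'.1]) ht'.2 (by linarith)
      nlinarith
  have := anti (Set.left_mem_Icc.2 (h1.trans hM)) (Set.mem_Icc.2 ⟨h1, hM⟩) h1
  simpa using this

lemma K_lower (ρ M x : ℝ) (hρ : 0 < ρ) (h1 : 1 ≤ x) (hM : x ≤ M) :
    (1 / 2) * ρ * (ρ + 1) * M ^ (-ρ - 2) * (x - 1) ^ 2 ≤ x ^ (-ρ) + ρ * x - (ρ + 1) := by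
  set c := (1 / 2) * ρ * (ρ + 1) * M ^ (-ρ - 2) with hc
  have hd : ∀ t ∈ Set.Icc 1 M, HasDerivAt
      (fun t : ℝ => t ^ (-ρ) + ρ * t - c * (t - 1) ^ 2)
      (-ρ * t ^ (-ρ - 1) + ρ - c * (2 * (t - 1))) t := by
    intro t ht
    have h0 : t ≠ 0 := by linarith [ht.1]
    have := ((Real.hasDerivAt_rpow_const (x := t) (p := -ρ) (Or.inl h0)).add
      ((hasDerivAt_id t).const_mul ρ)).sub
      ((((hasDerivAt_id t).sub_const 1).pow 2).const_mul c)
    exact this.congr_deriv (by simp)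
  have mono : MonotoneOn (fun t : ℝ => t ^ (-ρ) + ρ * t - c * (t - 1) ^ 2) (Set.Icc 1 M) := by
    apply monotoneOn_of_deriv_nonneg (convex_Icc 1 M)
    · intro t ht
      exact (hd t ht).continuousAt.continuousWithinAt
    · intro t ht
      exact (hd t (interior_subset ht)).differentiableAt.differentiableWithinAt
    · intro t ht
      have ht' := interior_subset ht
      rw [(hd t ht').deriv]
      have := K_rpow_step (ρ + 1) M t (by linarith) ht'.1 ht'.2
      rw [show -(ρ + 1) = -ρ - 1 by ring, show -ρ - 1 - 1 = -ρ - 2 by ring] at this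
      have := mul_le_mul_of_nonneg_left this hρ.le
      rw [hc]
      linarith
  have := mono (Set.left_mem_Icc.2 (h1.trans hM)) (Set.mem_Icc.2 ⟨h1, hM⟩) h1
  simp only [Real.one_rpow] at this
  linarith

lemma K_upper2 (ρ x : ℝ) (hρ : 0 < ρ) (h1 : 1 ≤ x) :
    x ^ (-ρ) + ρ * x - (ρ + 1) ≤ ρ * (ρ + 1) * (x - 1) ^ 2 := by
  have hx : 0 < x := by linarith
  have hb := one_add_mul_self_le_rpow_one_add (s := x - 1) (p := 1 + ρ) (by linarith) (by linarith)
  rw [show 1 + (x - 1) = x by ring] at hb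
  have hp : 0 < x ^ (-ρ - 1) := Real.rpow_pos_of_pos hx _
  have e1 : x ^ (-ρ - 1) * x ^ (1 + ρ) = 1 := by
    rw [← Real.rpow_add hx, show -ρ - 1 + (1 + ρ) = 0 by ring, Real.rpow_zero]
  have e2 : x ^ (-ρ) = x ^ (-ρ - 1) * x := by
    rw [← Real.rpow_add_one hx.ne']; norm_num
  have hk := mul_le_mul_of_nonneg_left hb hp.le
  rw [e1] at hk
  have hl : 1 - (ρ + 1) * (x - 1) ≤ x ^ (-ρ - 1) := by
    rw [Real.rpow_def_of_pos hx]
    have := Real.add_one_le_exp (Real.log x * (-ρ - 1))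
    have := Real.log_le_sub_one_of_pos hx
    nlinarith
  have h3 : (1 - x ^ (-ρ - 1)) * (ρ * (x - 1)) ≤ ((ρ + 1) * (x - 1)) * (ρ * (x - 1)) :=
    mul_le_mul_of_nonneg_right (by linarith) (mul_nonneg hρ.le (by linarith))
  rw [e2]
  nlinarith

lemma K_upper1 (ρ x : ℝ) (hρ : 0 < ρ) (h1 : 1 ≤ x) :
    x ^ (-ρ) + ρ * x - (ρ + 1) ≤ ρ * (x - 1) := by
  have := Real.rpow_le_one_of_one_le_of_nonpos h1 (by linarith : -ρ ≤ 0)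
  linarith

lemma ratio_bounds (u z : ℝ) (hu : 3 < u) (hz : 0 < z) :
    1 ≤ Real.log (u + z) / Real.log u ∧
      Real.log (u + z) / Real.log u - 1 ≤ z / (u * Real.log u) := by
  have hl : 0 < Real.log u := Real.log_pos (by linarith)
  have hu0 : 0 < u := by linarith
  constructor
  · rw [le_div_iff₀ hl, one_mul]
    exact Real.log_le_log hu0 (by linarith)
  · have h : Real.log (u + z) - Real.log u ≤ z / u := by
      rw [← Real.log_div (by positivity) hu0.ne']
      have := Real.log_le_sub_one_of_pos (x := (u + z) / u) (by positivity)
      have e : (u + z) / u - 1 = z / u := by field_simp; ring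
      linarith
    have e : Real.log (u + z) / Real.log u - 1 = (Real.log (u + z) - Real.log u) / Real.log u := by
      field_simp
    rw [e, ← div_div]
    gcongr

lemma Kfun_nonneg (ρ u z : ℝ) (hρ : 0 < ρ) (hu : 3 < u) (hz : 0 < z) : 0 ≤ Kfun ρ u z := by
  have h := ratio_bounds u z hu hz
  have := K_lower ρ _ _ hρ h.1 le_rfl
  unfold Kfun
  refine le_trans ?_ this
  have : 0 ≤ Real.log (u + z) / Real.log u := by linarith [h.1]
  positivity

lemma Kfun_measurable (ρ u : ℝ) : Measurable (Kfun ρ u) := by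
  unfold Kfun
  fun_prop

lemma dens_const_pos (α : ℝ) (hα1 : 1 < α) (hα2 : α < 2) :
    0 < α * (α - 1) / Real.Gamma (2 - α) := by
  have := Real.Gamma_pos_of_pos (show 0 < 2 - α by linarith)
  have : 0 < α - 1 := by linarith
  positivity

lemma mu_eq (α : ℝ) : muAlpha α = (volume.restrict (Set.Ioi 0)).withDensity
    (fun z => ENNReal.ofReal ((α * (α - 1) / Real.Gamma (2 - α)) * z ^ (-1 - α))) := by
  unfold muAlpha
  exact restrict_withDensity measurableSet_Ioi _

lemma K_integrable (ρ α u : ℝ) (hρ : 0 < ρ) (hα1 : 1 < α) (hα2 : α < 2) (hu : 3 < u) :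
    Integrable (Kfun ρ u) (muAlpha α) := by
  have hD := dens_const_pos α hα1 hα2
  set D := α * (α - 1) / Real.Gamma (2 - α) with hDdef
  rw [mu_eq, integrable_withDensity_iff (by fun_prop) (by simp)]
  change IntegrableOn _ (Set.Ioi 0) volume
  have hm : Measurable (fun x => Kfun ρ u x * (ENNReal.ofReal (D * x ^ (-1 - α))).toReal) :=
    (Kfun_measurable ρ u).mul (by fun_prop)
  have hl : 0 < Real.log u := Real.log_pos (by linarith)
  set B := u * Real.log u with hB
  have hB0 : 0 < B := by have : 0 < u := by linarith
                         positivity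
  rw [← Set.Ioc_union_Ioi_eq_Ioi (zero_le_one (α := ℝ))]
  refine IntegrableOn.union ?_ ?_
  · have hi : IntegrableOn (fun x : ℝ => ρ * (ρ + 1) / B ^ 2 * D * x ^ (1 - α)) (Set.Ioc 0 1) := by
      have := (intervalIntegral.intervalIntegrable_rpow' (a := 0) (b := 1)
        (r := 1 - α) (by linarith)).const_mul (ρ * (ρ + 1) / B ^ 2 * D)
      rwa [intervalIntegrable_iff_integrableOn_Ioc_of_le zero_le_one] at this
    refine Integrable.mono' hi hm.aestronglyMeasurable ?_
    refine (ae_restrict_mem measurableSet_Ioc).mono fun x hx => ?_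
    have hx0 : 0 < x := hx.1
    have hr := ratio_bounds u x hu hx0
    have hp : 0 < x ^ (-1 - α) := Real.rpow_pos_of_pos hx0 _
    rw [ENNReal.toReal_ofReal (by positivity), Real.norm_of_nonneg
      (mul_nonneg (Kfun_nonneg ρ u x hρ hu hx0) (by positivity))]
    have e : x ^ (1 - α) = x ^ (-1 - α) * x ^ 2 := by
      rw [← Real.rpow_add_natCast hx0.ne']; congr 1; push_cast; ring
    have hk : Kfun ρ u x ≤ ρ * (ρ + 1) * (x / B) ^ 2 := by
      refine (K_upper2 ρ _ hρ hr.1).trans ?_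
      have : 0 ≤ Real.log (u + x) / Real.log u - 1 := by linarith [hr.1]
      gcongr
      exact hr.2
    refine (mul_le_mul_of_nonneg_right hk (by positivity)).trans (le_of_eq ?_)
    rw [e]; field_simp; exact hDdef.symm
  · have hi : IntegrableOn (fun x : ℝ => ρ / B * D * x ^ (-α)) (Set.Ioi 1) :=
      (integrableOn_Ioi_rpow_of_lt (by linarith) one_pos).const_mul _
    refine Integrable.mono' hi hm.aestronglyMeasurable ?_
    refine (ae_restrict_mem measurableSet_Ioi).mono fun x hx => ?_
    have hx0 : 0 < x := lt_trans one_pos hx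
    have hr := ratio_bounds u x hu hx0
    have hp : 0 < x ^ (-1 - α) := Real.rpow_pos_of_pos hx0 _
    rw [ENNReal.toReal_ofReal (by positivity), Real.norm_of_nonneg
      (mul_nonneg (Kfun_nonneg ρ u x hρ hu hx0) (by positivity))]
    have e : x ^ (-α) = x ^ (-1 - α) * x := by
      rw [← Real.rpow_add_one hx0.ne']; congr 1; ring
    have hk : Kfun ρ u x ≤ ρ * (x / B) := by
      refine (K_upper1 ρ _ hρ hr.1).trans ?_
      gcongr
      exact hr.2
    refine (mul_le_mul_of_nonneg_right hk (by positivity)).trans (le_of_eq ?_)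
    rw [e]; field_simp; exact hDdef.symm

lemma mu_Icc (α a b : ℝ) (hα1 : 1 < α) (hα2 : α < 2) (ha : 0 < a) (hab : a ≤ b) :
    muAlpha α (Set.Icc a b) = ENNReal.ofReal
      ((α * (α - 1) / Real.Gamma (2 - α)) * ((b ^ (-α) - a ^ (-α)) / (-α))) := by
  have hD := dens_const_pos α hα1 hα2
  have hnot : (0 : ℝ) ∉ Set.uIcc a b := by
    rw [Set.uIcc_of_le hab]; intro h; linarith [h.1]
  have hsub : Set.Icc a b ∩ Set.Ioi 0 = Set.Icc a b :=
    Set.inter_eq_left.2 (fun x hx => lt_of_lt_of_le ha hx.1)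
  unfold muAlpha
  rw [Measure.restrict_apply measurableSet_Icc, hsub, withDensity_apply _ measurableSet_Icc,
    ← ofReal_integral_eq_lintegral_ofReal]
  · rw [integral_const_mul, integral_Icc_eq_integral_Ioc,
      ← intervalIntegral.integral_of_le hab, integral_rpow (Or.inr ⟨by linarith, hnot⟩),
      show -1 - α + 1 = -α by ring]
  · change IntegrableOn _ _ _
    rw [integrableOn_Icc_iff_integrableOn_Ioc,
      ← intervalIntegrable_iff_integrableOn_Ioc_of_le hab]
    exact (intervalIntegral.intervalIntegrable_rpow (Or.inr hnot)).const_mul _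
  · refine (ae_restrict_mem measurableSet_Icc).mono fun x hx => ?_
    have hx0 : 0 < x := lt_of_lt_of_le ha hx.1
    have : 0 < x ^ (-1 - α) := Real.rpow_pos_of_pos hx0 _
    simp only [Pi.zero_apply]
    positivity

lemma mu_scale (α u : ℝ) (hα1 : 1 < α) (hα2 : α < 2) (hu : 0 < u) :
    (muAlpha α (Set.Icc u (u * 2))).toReal = u ^ (-α) * (muAlpha α (Set.Icc 1 2)).toReal := by
  rw [mu_Icc α u (u * 2) hα1 hα2 hu (by linarith), mu_Icc α 1 2 hα1 hα2 one_pos (by norm_num)]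
  have hp : 0 < u ^ (-α) := Real.rpow_pos_of_pos hu _
  rw [← ENNReal.toReal_ofReal hp.le, ← ENNReal.toReal_mul, ← ENNReal.ofReal_mul hp.le,
    ENNReal.toReal_ofReal hp.le,
    Real.mul_rpow hu.le (by norm_num), Real.one_rpow]
  congr 2
  ring

theorem stmt_6 (ρ α : ℝ) (hρ : 0 < ρ) (hα1 : 1 < α) (hα2 : α < 2) :
    ∀ u : ℝ, 3 < u →
      (∫ z in Set.Ioi (0 : ℝ), Kfun ρ u z ∂(muAlpha α)) ≥
        (1 / 8) * ρ * (ρ + 1) * Real.log (3 / 2) ^ 2 *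
          (1 + Real.log 3 / Real.log u) ^ (-ρ - 2) * u ^ (-α) * Real.log u ^ (-2 : ℝ) *
          (muAlpha α (Set.Icc 1 2)).toReal := by
  intro u hu
  have hu0 : 0 < u := by linarith
  have hl : 0 < Real.log u := Real.log_pos (by linarith)
  have hl3 : 0 < Real.log 3 := Real.log_pos (by norm_num)
  have hl32 : 0 < Real.log (3 / 2) := Real.log_pos (by norm_num)
  have hint := K_integrable ρ α u hρ hα1 hα2 hu
  set M := 1 + Real.log 3 / Real.log u with hM
  have hM0 : 0 < M := by positivity
  set c := (1 / 8) * ρ * (ρ + 1) * Real.log (3 / 2) ^ 2 * M ^ (-ρ - 2) * Real.log u ^ (-2 : ℝ)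
    with hc
  have hfin : muAlpha α (Set.Icc u (u * 2)) ≠ ⊤ := by
    rw [mu_Icc α u (u * 2) hα1 hα2 hu0 (by linarith)]; exact ENNReal.ofReal_ne_top
  have key : ∀ z ∈ Set.Icc u (u * 2), c ≤ Kfun ρ u z := by
    intro z hz
    have hz0 : 0 < z := hu0.trans_le hz.1
    have hr := ratio_bounds u z hu hz0
    have hup : Real.log (u + z) / Real.log u ≤ M := by
      rw [hM, div_le_iff₀ hl, add_mul, div_mul_cancel₀ _ hl.ne', one_mul,
        ← Real.log_mul hu0.ne' (by norm_num)]
      exact Real.log_le_log (by linarith) (by linarith [hz.2])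
    have hlow : Real.log (3 / 2) / Real.log u ≤ Real.log (u + z) / Real.log u - 1 := by
      rw [le_sub_iff_add_le, le_div_iff₀ hl, add_mul, div_mul_cancel₀ _ hl.ne', one_mul,
        ← Real.log_mul (by norm_num) hu0.ne']
      exact Real.log_le_log (by linarith) (by linarith [hz.1])
    refine le_trans ?_ (K_lower ρ M _ hρ hr.1 hup)
    have hMp : 0 < M ^ (-ρ - 2) := Real.rpow_pos_of_pos hM0 _
    have h2 : (Real.log (3 / 2) / Real.log u) ^ 2 ≤ (Real.log (u + z) / Real.log u - 1) ^ 2 := by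
      gcongr
    have e : Real.log u ^ (-2 : ℝ) = (Real.log u ^ 2)⁻¹ := by
      rw [Real.rpow_neg hl.le]; norm_num
    have e2 : c = (1 / 8) * ρ * (ρ + 1) * M ^ (-ρ - 2) * (Real.log (3 / 2) / Real.log u) ^ 2 := by
      rw [hc, e]; field_simp
    rw [e2]
    gcongr
    norm_num
  have step1 : c * (muAlpha α (Set.Icc u (u * 2))).toReal ≤
      ∫ z in Set.Icc u (u * 2), Kfun ρ u z ∂(muAlpha α) := by
    have := setIntegral_mono_on (μ := muAlpha α) (s := Set.Icc u (u * 2)) (f := fun _ => c)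
      (g := Kfun ρ u) (integrableOn_const hfin) hint.integrableOn measurableSet_Icc key
    rw [setIntegral_const] at this
    simpa [Measure.real, mul_comm] using this
  have step2 : ∫ z in Set.Icc u (u * 2), Kfun ρ u z ∂(muAlpha α) ≤
      ∫ z in Set.Ioi 0, Kfun ρ u z ∂(muAlpha α) := by
    refine setIntegral_mono_set hint.integrableOn ?_ ?_
    · exact (ae_restrict_mem measurableSet_Ioi).mono fun z hz => Kfun_nonneg ρ u z hρ hu hz
    · exact Filter.Eventually.of_forall fun z hz => lt_of_lt_of_le hu0 hz.1
  rw [mu_scale α u hα1 hα2 hu0] at step1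
  refine ge_iff_le.2 (le_trans (le_of_eq ?_) (step1.trans step2))
  rw [hc]; ring
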